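/- arXiv:1602.07541 — 3 statements merged into one kernel-verified Lean document; each statement's English description precedes it below -/
import Mathlib

section
/- Let a small category G act partially on a set X and let Y = X̄/≃ with the global category action g·[h,x] = [gh',x'] (defined iff some (h',x') ≃ (h,x) has (g,h') ∈ G²). The map i : X → Y given by i(x) = [e,x], for any e ∈ ob(G) with e·x defined, is well defined (independent of the choice of e), is an injective G-function, and the global action of G on i(X) induces the original partial action of G on X: for y, z ∈ X and g ∈ mor(G), if g·i(y) is defined and equals i(z), then g·y is defined and equals z. -/
universe u v w

/-- A small category presented in "morphisms-only" style: `M` is the set of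
morphisms, objects are identified with their identity morphisms (the predicate
`obj`), `src`/`tgt` give the domain/codomain (as identity morphisms), and `mul`
is composition (its value is only relevant on composable pairs, i.e. those
`(g, h)` with `src g = tgt h`). -/
structure PartialCat (M : Type u) where
  src : M → M
  tgt : M → M
  mul : M → M → M
  obj : M → Prop
  obj_src : ∀ g, obj (src g)
  obj_tgt : ∀ g, obj (tgt g)
  src_obj : ∀ e, obj e → src e = e
  tgt_obj : ∀ e, obj e → tgt e = e
  src_mul : ∀ g h, src g = tgt h → src (mul g h) = src h
  tgt_mul : ∀ g h, src g = tgt h → tgt (mul g h) = tgt g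
  mul_src_self : ∀ g, mul g (src g) = g
  tgt_mul_self : ∀ g, mul (tgt g) g = g
  mul_assoc : ∀ g h k, src g = tgt h → src h = tgt k → mul (mul g h) k = mul g (mul h k)

/-- A partial category action of `G` on `X`, encoded as `act : M → X → Option X`
(`g·x` is defined iff `act g x = some y`, with value `y`).  The fields are the
axioms (C1) (split into two parts), (C2) and (C3); note that for `act h x = some y`,
the `Option`-equality `act (mul g h) x = act g y` says precisely that `(gh)·x` is
defined iff `g·(h·x)` is, and in that case the values agree. -/
structure IsPartialCatAction {M : Type u} {X : Type v} (C : PartialCat M)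
    (act : M → X → Option X) : Prop where
  exists_obj_defined : ∀ x : X, ∃ e : M, C.obj e ∧ (act e x).isSome
  obj_act_eq : ∀ (f : M) (x y : X), C.obj f → act f x = some y → y = x
  src_defined : ∀ (g : M) (x : X), (act g x).isSome → (act (C.src g) x).isSome
  comp_act : ∀ (g h : M) (x y : X), C.src g = C.tgt h → act h x = some y →
    act (C.mul g h) x = act g y

/-- Axiom (C4): the action is global. -/
def IsGlobal {M : Type u} {X : Type v} (C : PartialCat M) (act : M → X → Option X) : Prop :=
  ∀ (g : M) (x : X), (act (C.src g) x).isSome → (act g x).isSome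

/-- `i : X → Y` is a `G`-function: whenever `g·x` is defined, `g·i(x)` is defined
and equals `i(g·x)`. -/
def IsGFun {M : Type u} {X : Type v} {Y : Type w}
    (actX : M → X → Option X) (actY : M → Y → Option Y) (i : X → Y) : Prop :=
  ∀ (g : M) (x y : X), actX g x = some y → actY g (i x) = some (i y)

/-- `X_g = {x : g·x is defined}`. -/
def actSet {M : Type u} {X : Type v} (act : M → X → Option X) (g : M) : Set X :=
  {x | (act g x).isSome}

/-- `₍g₎X = {g·x : x ∈ X_g}`. -/
def actImg {M : Type u} {X : Type v} (act : M → X → Option X) (g : M) : Set X :=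
  {y | ∃ x, act g x = some y}

/-- `X̄ = {(g,x) : d(g)·x is defined}`. -/
def Xbar {M : Type u} {X : Type v} (C : PartialCat M) (act : M → X → Option X) :
    Set (M × X) :=
  {p | (act (C.src p.1) p.2).isSome}

/-- The relation `∼` on `X̄`: `(g,x) ∼ (g',x')` iff (i) there is `h` with
`(g',h)` composable, `h·x` defined, `g = g'h` and `x' = h·x`, or (ii) `x = x'`,
`g, g'` are objects and both `g·x`, `g'·x'` are defined. -/
def simRel {M : Type u} {X : Type v} (C : PartialCat M) (act : M → X → Option X)
    (p q : M × X) : Prop :=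
  (∃ h : M, C.src q.1 = C.tgt h ∧ ∃ y : X, act h p.2 = some y ∧
    p.1 = C.mul q.1 h ∧ q.2 = y) ∨
  (p.2 = q.2 ∧ C.obj p.1 ∧ C.obj q.1 ∧ (act p.1 p.2).isSome ∧ (act q.1 q.2).isSome)

/-- The relation `∼` regarded as a relation on `M × X` supported on `X̄`. -/
def simRelBar {M : Type u} {X : Type v} (C : PartialCat M) (act : M → X → Option X)
    (p q : M × X) : Prop :=
  p ∈ Xbar C act ∧ q ∈ Xbar C act ∧ simRel C act p q

/-- `≃`, the equivalence relation generated by `∼`. -/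
def eqvRel {M : Type u} {X : Type v} (C : PartialCat M) (act : M → X → Option X) :
    M × X → M × X → Prop :=
  Relation.EqvGen (simRelBar C act)

/-- `X̄` as a type (with the subspace topology when relevant). -/
abbrev XbarT {M : Type u} {X : Type v} (C : PartialCat M) (act : M → X → Option X) :
    Type (max u v) :=
  {p : M × X // p ∈ Xbar C act}

/-- `≃` as a relation on the type `X̄`. -/
def eqvT {M : Type u} {X : Type v} (C : PartialCat M) (act : M → X → Option X)
    (p q : XbarT C act) : Prop :=
  eqvRel C act p.1 q.1

/-- `Y = X̄ / ≃` (with the quotient topology when relevant). -/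
abbrev Yglob {M : Type u} {X : Type v} (C : PartialCat M) (act : M → X → Option X) :
    Type (max u v) :=
  Quot (eqvT C act)

/-- `[g, x]`, the class of `(g,x) ∈ X̄` in `Y`. -/
def mkY {M : Type u} {X : Type v} (C : PartialCat M) (act : M → X → Option X)
    (p : XbarT C act) : Yglob C act :=
  Quot.mk _ p

/-- Characterization of the induced action on `Y = X̄/≃`: `g·[h,x]` is defined iff
some `(h',x') ≃ (h,x)` has `(g,h')` composable, in which case `g·[h,x] = [gh',x']`. -/
def ActYSpec {M : Type u} {X : Type v} (C : PartialCat M) (act : M → X → Option X)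
    (actY : M → Yglob C act → Option (Yglob C act)) : Prop :=
  ∀ (g : M) (p : XbarT C act),
    ((actY g (mkY C act p)).isSome ↔
      ∃ q : XbarT C act, eqvT C act p q ∧ C.src g = C.tgt q.1.1) ∧
    (∀ q : XbarT C act, eqvT C act p q → C.src g = C.tgt q.1.1 →
      ∃ hm : (C.mul g q.1.1, q.1.2) ∈ Xbar C act,
        actY g (mkY C act p) = some (mkY C act ⟨(C.mul g q.1.1, q.1.2), hm⟩))

/-- Characterization of `i : X → Y`: `i x = [e, x]` for every object `e` with
`e·x` defined. -/
def ISpec {M : Type u} {X : Type v} (C : PartialCat M) (act : M → X → Option X)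
    (i : X → Yglob C act) : Prop :=
  ∀ (x : X) (e : M), C.obj e → (act e x).isSome →
    ∃ hm : (e, x) ∈ Xbar C act, i x = mkY C act ⟨(e, x), hm⟩

/-- A small groupoid in morphisms-only style: a `PartialCat` in which every
morphism `g` has an inverse `inv g`. -/
structure PartialGpd (M : Type u) extends PartialCat M where
  inv : M → M
  src_inv : ∀ g, src (inv g) = tgt g
  tgt_inv : ∀ g, tgt (inv g) = src g
  inv_mul_self : ∀ g, mul (inv g) g = src g
  mul_inv_self : ∀ g, mul g (inv g) = tgt g

/-- A partial groupoid action: axioms (GR1) (split into two parts), (GR2), (GR3). -/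
structure IsPartialGpdAction {M : Type u} {X : Type v} (C : PartialGpd M)
    (act : M → X → Option X) : Prop where
  exists_obj_defined : ∀ x : X, ∃ e : M, C.obj e ∧ (act e x).isSome
  obj_act_eq : ∀ (f : M) (x y : X), C.obj f → act f x = some y → y = x
  inv_act : ∀ (g : M) (x y : X), act g x = some y → act (C.inv g) y = some x
  comp_act : ∀ (g h : M) (x y z : X), C.src g = C.tgt h → act h x = some y →
    act g y = some z → act (C.mul g h) x = some z

/-- `G` is a topological category: composition `G² → mor(G)` is continuous,
where `G²` carries the subspace topology from `mor(G) × mor(G)`. -/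
def ContComp {M : Type u} [TopologicalSpace M] (C : PartialCat M) : Prop :=
  Continuous (fun p : {q : M × M // C.src q.1 = C.tgt q.2} => C.mul p.1.1 p.1.2)

/-- Axioms (CA1) and (CA2): the sets `X_e` (`e` an object) are open, and the
action map `Γ → X` is continuous, where `Γ = {(g,x) : g·x defined}` carries the
subspace topology from `mor(G) × X`. -/
def IsContAction {M : Type u} {X : Type v} [TopologicalSpace M] [TopologicalSpace X]
    (C : PartialCat M) (act : M → X → Option X) : Prop :=
  (∀ e : M, C.obj e → IsOpen {x : X | (act e x).isSome}) ∧
  Continuous (fun p : {q : M × X // (act q.1 q.2).isSome} => (act p.1.1 p.1.2).get p.2)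

/-- `G` is star open: each `d⁻¹(e)` is open. -/
def IsStarOpen {M : Type u} [TopologicalSpace M] (C : PartialCat M) : Prop :=
  ∀ e : M, C.obj e → IsOpen {g : M | C.src g = e}

/-- The action is graph open: `Γ` is open in `mor(G) × X`. -/
def IsGraphOpen {M : Type u} {X : Type v} [TopologicalSpace M] [TopologicalSpace X]
    (act : M → X → Option X) : Prop :=
  IsOpen {p : M × X | (act p.1 p.2).isSome}

/-- `Γ' = {(g,(h,x)) ∈ mor(G) × X̄ : d(g) = c(h)}`, with the subspace topology
from `mor(G) × mor(G) × X`. -/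
abbrev GammaP {M : Type u} {X : Type v} (C : PartialCat M) (act : M → X → Option X) :
    Type (max u v) :=
  {q : M × XbarT C act // C.src q.1 = C.tgt q.2.1.1}

/-- The relation `≡` on `Γ'`: `(g,(h,x)) ≡ (g',(h',x'))` iff `g = g'` and
`(h,x) ≃ (h',x')`. -/
def gammaEqv {M : Type u} {X : Type v} (C : PartialCat M) (act : M → X → Option X)
    (a b : GammaP C act) : Prop :=
  a.1.1 = b.1.1 ∧ eqvT C act a.1.2 b.1.2

/-- `Γ'' = Γ' / ≡`, with the quotient topology. -/
abbrev GammaQ {M : Type u} {X : Type v} (C : PartialCat M) (act : M → X → Option X) :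
    Type (max u v) :=
  Quot (gammaEqv C act)

/-- Characterization of the map `Γ'' → Y` induced by `(g,(h,x)) ↦ [gh, x]`. -/
def BetaSpec {M : Type u} {X : Type v} (C : PartialCat M) (act : M → X → Option X)
    (β : GammaQ C act → Yglob C act) : Prop :=
  ∀ a : GammaP C act, ∃ hm : (C.mul a.1.1 a.1.2.1.1, a.1.2.1.2) ∈ Xbar C act,
    β (Quot.mk _ a) = mkY C act ⟨(C.mul a.1.1 a.1.2.1.1, a.1.2.1.2), hm⟩

/-- If `(g,x) ≃ (h,y)`, then `g·x` and `h·y` are both undefined, or both defined and equal. -/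
theorem eqvRel.act_eq {M : Type u} {X : Type v} {C : PartialCat M} {act : M → X → Option X}
    (hact : IsPartialCatAction C act) {p q : M × X} (hpq : eqvRel C act p q) :
    act p.1 p.2 = act q.1 q.2 := by
  have obj_act : ∀ {e : M} {x : X}, C.obj e → (act e x).isSome → act e x = some x := by
    intro e x he hx
    obtain ⟨y, hy⟩ := Option.isSome_iff_exists.mp hx
    rw [hy, hact.obj_act_eq e x y he hy]
  induction hpq with
  | rel p q h =>
    obtain ⟨-, -, ⟨h, hcomp, y, hy, hp, hq⟩ | ⟨hx, hp, hq, hps, hqs⟩⟩ := h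
    · rw [hp, hq, hact.comp_act _ h _ y hcomp hy]
    · rw [obj_act hp hps, obj_act hq hqs, hx]
  | refl => rfl
  | symm _ _ _ ih => exact ih.symm
  | trans _ _ _ _ _ ih₁ ih₂ => exact ih₁.trans ih₂

/-- The map `Y → Option X` sending `[g,x]` to `g·x`. -/
def Yglob.actValue {M : Type u} {X : Type v} {C : PartialCat M} {act : M → X → Option X}
    (hact : IsPartialCatAction C act) : Yglob C act → Option X :=
  Quot.lift (fun p => act p.1.1 p.1.2) fun _ _ h => eqvRel.act_eq hact h

theorem Yglob.actValue_mkY {M : Type u} {X : Type v} {C : PartialCat M} {act : M → X → Option X}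
    (hact : IsPartialCatAction C act) (p : XbarT C act) :
    Yglob.actValue hact (mkY C act p) = act p.1.1 p.1.2 :=
  rfl

theorem mem_Xbar_of_obj {M : Type u} {X : Type v} {C : PartialCat M} {act : M → X → Option X}
    {e : M} {x : X} (he : C.obj e) (hx : (act e x).isSome) : (e, x) ∈ Xbar C act := by
  simpa [Xbar, C.src_obj e he] using hx

theorem mkY_eq_of_simRel {M : Type u} {X : Type v} {C : PartialCat M} {act : M → X → Option X}
    {p q : XbarT C act} (h : simRel C act p.1 q.1) : mkY C act p = mkY C act q :=
  Quot.sound (Relation.EqvGen.rel _ _ ⟨p.2, q.2, h⟩)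

/-- The map `i : X → Y`, `i(x) = [e,x]` for any object `e` with
`e·x` defined, is well defined (the existence of `i` satisfying `ISpec` expresses
this), injective, a `G`-function, and the global action of `G` on `i(X)` induces
the original partial action: if `g·i(y)` is defined and equals `i(z)`, then `g·y`
is defined and equals `z`. -/
theorem stmt10 {M X : Type u} (C : PartialCat M) (act : M → X → Option X)
    (hact : IsPartialCatAction C act)
    (actY : M → Yglob C act → Option (Yglob C act))
    (hspec : ActYSpec C act actY)
    (hYact : IsPartialCatAction C actY) (hYglob : IsGlobal C actY) :
    ∃ i : X → Yglob C act,
      ISpec C act i ∧ Function.Injective i ∧ IsGFun act actY i ∧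
      (∀ (g : M) (y z : X), actY g (i y) = some (i z) → act g y = some z) := by
  choose e he hex using hact.exists_obj_defined
  let i : X → Yglob C act := fun x => mkY C act ⟨(e x, x), mem_Xbar_of_obj (he x) (hex x)⟩
  have hi : ISpec C act i := fun x f hf hfx =>
    ⟨mem_Xbar_of_obj hf hfx, mkY_eq_of_simRel (.inr ⟨rfl, he x, hf, hex x, hfx⟩)⟩
  have act_e : ∀ x, act (e x) x = some x := by
    intro x
    obtain ⟨y, hy⟩ := Option.isSome_iff_exists.mp (hex x)
    rw [hy, hact.obj_act_eq _ x y (he x) hy]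
  have actValue_i : ∀ x, Yglob.actValue hact (i x) = some x := act_e
  refine ⟨i, hi, fun x y hxy => ?_, fun g x y hgx => ?_, fun g y z hg => ?_⟩
  · have h := actValue_i x
    rw [hxy, actValue_i y] at h
    exact (Option.some.inj h).symm
  · have hsrc := hact.src_defined g x (by simp [hgx])
    obtain ⟨hm, hix⟩ := hi x _ (C.obj_src g) hsrc
    have htgt : act (C.tgt g) y = some y := by
      rw [← hact.comp_act (C.tgt g) g x y (C.src_obj _ (C.obj_tgt g)) hgx, C.tgt_mul_self, hgx]
    obtain ⟨hm', hiy⟩ := hi y _ (C.obj_tgt g) (by simp [htgt])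
    obtain ⟨hmul, hact_src⟩ := (hspec g ⟨(C.src g, x), hm⟩).2 ⟨(C.src g, x), hm⟩
      (Relation.EqvGen.refl _) (C.tgt_obj _ (C.obj_src g)).symm
    rw [hix, hact_src, hiy]
    refine congrArg some (mkY_eq_of_simRel (.inl ⟨g, C.src_obj _ (C.obj_tgt g), y, hgx, ?_, rfl⟩))
    simp [C.mul_src_self, C.tgt_mul_self]
  · obtain ⟨hdef, hval⟩ := hspec g ⟨(e y, y), mem_Xbar_of_obj (he y) (hex y)⟩
    obtain ⟨q, hq, hcomp⟩ := hdef.mp (Option.isSome_iff_exists.mpr ⟨_, hg⟩)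
    obtain ⟨hm, hgq⟩ := hval q hq hcomp
    have hqy : act q.1.1 q.1.2 = some y := (eqvRel.act_eq hact hq).symm.trans (act_e y)
    have hz := actValue_i z
    rw [← Option.some.inj (hgq.symm.trans hg), Yglob.actValue_mkY] at hz
    rw [← hact.comp_act g _ _ y hcomp hqy, hz]
end

section
/- Let a small category G act partially on a set X, let Y = X̄/≃ carry the induced global category action, and let i : X → Y be given by i(x) = [e,x] for any e ∈ ob(G) with e·x defined. Let Z be a set with a global category action of G and j : X → Z a G-function. Then: for every (g,x) ∈ X̄, g·j(x) is defined; the map k : Y → Z defined by k([g,x]) = g·j(x) is well defined (depends only on the class [g,x]); k is a G-function; j = k ∘ i; and k is the unique G-function Y → Z with j = k ∘ i. -/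
universe u v w

/-- The extension `(g, x) ↦ g·j(x)` of a `G`-function `j` is invariant under `≃`. -/
theorem act_eq_of_eqvRel {M : Type u} {X : Type v} {Z : Type w} {C : PartialCat M}
    {act : M → X → Option X} (hact : IsPartialCatAction C act) {actZ : M → Z → Option Z}
    (hZact : IsPartialCatAction C actZ) {j : X → Z} (hj : IsGFun act actZ j)
    {p q : M × X} (h : eqvRel C act p q) : actZ p.1 (j p.2) = actZ q.1 (j q.2) := by
  have obj_act : ∀ (e : M) (x : X), C.obj e → (act e x).isSome →
      actZ e (j x) = some (j x) := by
    intro e x he hx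
    obtain ⟨y, hy⟩ := Option.isSome_iff_exists.1 hx
    obtain rfl := hact.obj_act_eq e x y he hy
    exact hj e y y hy
  induction h with
  | rel p q h =>
    obtain ⟨-, -, ⟨h, hc, y, hy, hp, hq⟩ | ⟨hx, hp, hq, hpx, hqx⟩⟩ := h
    · rw [hp, hq]
      exact hZact.comp_act q.1 h (j p.2) (j y) hc (hj h _ _ hy)
    · rw [obj_act _ _ hp hpx, obj_act _ _ hq hqx, hx]
  | refl => rfl
  | symm _ _ _ ih => exact ih.symm
  | trans _ _ _ _ _ ih₁ ih₂ => exact ih₁.trans ih₂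

/-- The class `[g, x]` is `g` applied to `[d(g), x]`. -/
theorem actY_of_mem_Xbar {M : Type u} {X : Type v} {C : PartialCat M}
    {act : M → X → Option X} {actY : M → Yglob C act → Option (Yglob C act)}
    (hspec : ActYSpec C act actY) {i : X → Yglob C act} (hi : ISpec C act i)
    (p : XbarT C act) : actY p.1.1 (i p.1.2) = some (mkY C act p) := by
  obtain ⟨⟨g, x⟩, hp⟩ := p
  obtain ⟨hm, hix⟩ := hi x (C.src g) (C.obj_src g) hp
  obtain ⟨hm', h⟩ := (hspec g ⟨(C.src g, x), hm⟩).2 ⟨(C.src g, x), hm⟩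
    (Relation.EqvGen.refl _) (C.tgt_obj _ (C.obj_src g)).symm
  simp only [hix, h, C.mul_src_self]

/-- Universality of `Y = X̄/≃`: for any set `Z` with a global
category action and any `G`-function `j : X → Z`, `g·j(x)` is defined for every
`(g,x) ∈ X̄`; the map `k([g,x]) = g·j(x)` is well defined (existence of `k`
satisfying the displayed specification); `k` is a `G`-function with `j = k ∘ i`,
and `k` is the unique such `G`-function. -/
theorem stmt11 {M X : Type u} (C : PartialCat M) (act : M → X → Option X)
    (hact : IsPartialCatAction C act)
    (actY : M → Yglob C act → Option (Yglob C act))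
    (hspec : ActYSpec C act actY)
    (hYact : IsPartialCatAction C actY) (hYglob : IsGlobal C actY)
    (i : X → Yglob C act) (hi : ISpec C act i)
    (Z : Type u) (actZ : M → Z → Option Z)
    (hZact : IsPartialCatAction C actZ) (hZglob : IsGlobal C actZ)
    (j : X → Z) (hj : IsGFun act actZ j) :
    (∀ p : M × X, p ∈ Xbar C act → (actZ p.1 (j p.2)).isSome) ∧
    ∃ k : Yglob C act → Z,
      (∀ p : XbarT C act, actZ p.1.1 (j p.1.2) = some (k (mkY C act p))) ∧
      IsGFun actY actZ k ∧ j = k ∘ i ∧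
      (∀ k' : Yglob C act → Z, IsGFun actY actZ k' → j = k' ∘ i → k' = k) := by
  have hdef : ∀ p : M × X, p ∈ Xbar C act → (actZ p.1 (j p.2)).isSome := by
    intro p hp
    obtain ⟨y, hy⟩ := Option.isSome_iff_exists.1 hp
    exact hZglob _ _ (by rw [hj _ _ _ hy]; rfl)
  refine ⟨hdef, ?_⟩
  let k : Yglob C act → Z := Quot.lift (fun p => (actZ p.1.1 (j p.1.2)).get (hdef p.1 p.2))
    fun p q h => by simp only [act_eq_of_eqvRel hact hZact hj h]
  have hk : ∀ p : XbarT C act, actZ p.1.1 (j p.1.2) = some (k (mkY C act p)) :=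
    fun p => (Option.some_get (hdef p.1 p.2)).symm
  refine ⟨k, hk, ?_, ?_, ?_⟩
  · intro g y y' hy
    obtain ⟨p, rfl⟩ := Quot.exists_rep y
    obtain ⟨q, hpq, hc⟩ := (hspec g p).1.1 (Option.isSome_iff_exists.2 ⟨y', hy⟩)
    obtain ⟨hm, hgq⟩ := (hspec g p).2 q hpq hc
    obtain rfl : y' = _ := Option.some.inj (hy.symm.trans hgq)
    have hkp : actZ q.1.1 (j q.1.2) = some (k (mkY C act p)) :=
      (act_eq_of_eqvRel hact hZact hj hpq).symm.trans (hk p)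
    exact (hZact.comp_act g q.1.1 _ _ hc hkp).symm.trans (hk ⟨_, hm⟩)
  · funext x
    obtain ⟨e, he, hex⟩ := hact.exists_obj_defined x
    obtain ⟨hm, hix⟩ := hi x e he hex
    have hkx := hk ⟨(e, x), hm⟩
    rw [← hix] at hkx
    exact (hZact.obj_act_eq e _ _ he hkx).symm
  · intro k' hk' hjk'
    funext y
    obtain ⟨p, rfl⟩ := Quot.exists_rep y
    have h := hk' _ _ _ (actY_of_mem_Xbar hspec hi p)
    rw [← Function.comp_apply (f := k') (g := i), ← hjk', hk p] at h
    exact (Option.some.inj h).symm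
end

section
/- Every partial monoid action of a monoid G on a set X admits a universal globalization: there exist a set Y with a global action of G and a G-function i : X → Y such that for every set Z with a global action of G and every G-function j : X → Z there is a unique G-function k : Y → Z with j = k ∘ i. -/
universe u v w

/-- The elementary identifications `(g * h, x) ∼ (g, h·x)`, for `h·x` defined, on `G × X`. -/
inductive GlobalizationRel {G : Type u} {X : Type v} [Monoid G] (act : G → X → Option X) :
    G × X → G × X → Prop
  | shift (g h : G) (x y : X) (hxy : act h x = some y) :
      GlobalizationRel act (g * h, x) (g, y)

/-- The quotient of `G × X` by the equivalence relation generated by `GlobalizationRel`. -/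
def Globalization {G : Type u} {X : Type v} [Monoid G] (act : G → X → Option X) :
    Type (max u v) :=
  Quot (GlobalizationRel act)

namespace Globalization

variable {G : Type u} {X : Type v} [Monoid G] {act : G → X → Option X}

/-- The class of `(g, x)`. -/
def mk (act : G → X → Option X) (g : G) (x : X) : Globalization act :=
  Quot.mk _ (g, x)

theorem mk_mul (g : G) {h : G} {x y : X} (hxy : act h x = some y) :
    mk act (g * h) x = mk act g y :=
  Quot.sound (.shift g h x y hxy)

theorem ind {p : Globalization act → Prop} (h : ∀ g x, p (mk act g x)) (y : Globalization act) :
    p y :=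
  Quot.ind (fun q => h q.1 q.2) y

/-- Left multiplication on the first component, as a global action on the quotient. -/
def smul (g : G) : Globalization act → Globalization act :=
  Quot.lift (fun p => mk act (g * p.1) p.2) (by
    rintro _ _ ⟨k, h, x, y, hxy⟩
    simpa only [mul_assoc] using mk_mul (g * k) hxy)

theorem smul_mk (g h : G) (x : X) : smul g (mk act h x) = mk act (g * h) x := rfl

/-- The map out of the quotient determined by a `G`-function into a global action. -/
def lift {Z : Type w} (actZ : G → Z → Z) (j : X → Z)
    (hmul : ∀ (g h : G) (z : Z), actZ (g * h) z = actZ g (actZ h z))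
    (hj : ∀ (g : G) (x y : X), act g x = some y → actZ g (j x) = j y) :
    Globalization act → Z :=
  Quot.lift (fun p => actZ p.1 (j p.2)) (by
    rintro _ _ ⟨g, h, x, y, hxy⟩
    simp only [hmul, hj h x y hxy])

end Globalization

/-- Every partial monoid action on a set admits a universal
globalization.  A partial monoid action is encoded by `act : G → X → Option X`
satisfying (M1) and (M2) (for `act h x = some y`, the `Option`-equality
`act (g*h) x = act g y` says `(gh)·x` is defined iff `g·(h·x)` is, with equal
values); global actions and `G`-functions as displayed. -/
theorem stmt19 {G X : Type u} [Monoid G] (act : G → X → Option X)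
    (hM1 : ∀ x : X, act 1 x = some x)
    (hM2 : ∀ (g h : G) (x y : X), act h x = some y → act (g * h) x = act g y) :
    ∃ (Y : Type u) (actY : G → Y → Y) (i : X → Y),
      (∀ y : Y, actY 1 y = y) ∧
      (∀ (g h : G) (y : Y), actY (g * h) y = actY g (actY h y)) ∧
      (∀ (g : G) (x y : X), act g x = some y → actY g (i x) = i y) ∧
      ∀ (Z : Type u) (actZ : G → Z → Z) (j : X → Z),
        (∀ z : Z, actZ 1 z = z) →
        (∀ (g h : G) (z : Z), actZ (g * h) z = actZ g (actZ h z)) →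
        (∀ (g : G) (x y : X), act g x = some y → actZ g (j x) = j y) →
        ∃! k : Y → Z, (∀ (g : G) (y : Y), k (actY g y) = actZ g (k y)) ∧ j = k ∘ i := by
  refine ⟨Globalization act, Globalization.smul, Globalization.mk act 1,
    Globalization.ind fun g x => ?_, fun g h => Globalization.ind fun k x => ?_,
    fun g x y hxy => ?_, fun Z actZ j hone hmul hj => ?_⟩
  · rw [Globalization.smul_mk, one_mul]
  · simp only [Globalization.smul_mk, mul_assoc]
  · rw [Globalization.smul_mk, mul_one, ← Globalization.mk_mul 1 hxy, one_mul]
  · refine ⟨Globalization.lift actZ j hmul hj,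
      ⟨fun g => Globalization.ind fun h x => hmul g h (j x), funext fun x => (hone (j x)).symm⟩, ?_⟩
    rintro k ⟨hk, rfl⟩
    refine funext (Globalization.ind fun g x => ?_)
    calc k (Globalization.mk act g x)
        = k (Globalization.smul g (Globalization.mk act 1 x)) := by
          rw [Globalization.smul_mk, mul_one]
      _ = actZ g (k (Globalization.mk act 1 x)) := hk g _
end
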